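/- There is a universal constant C₀ ≥ 1 such that the following holds for all integers d,k,μ ≥ 1 and all reals c > 0, ε > 0: for every c-packed (μ,ε)-curve P of complexity at most k in ℝ^d and every Δ > 0, there exists a set 𝒟 of c-packed (μ,ε)-curves of complexity at most k in ℝ^d with |𝒟| ≤ (C₀^d · (c+1) · μ)^k such that every c-packed (μ,ε)-curve Q of complexity at most k with d_F(P,Q) ≤ Δ satisfies d_F(Q,Q*) ≤ Δ/2 for some Q* ∈ 𝒟. (Hence the doubling constant of the space of c-packed (μ,ε)-curves of complexity at most k is at most (C₀^d·(c+1)·μ)^k, and its doubling dimension is O(k(d + log(cμ))).) -/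

import Mathlib

open Set Metric Function

noncomputable section

/-- Euclidean space ℝ^d. -/
abbrev Euc (d : ℕ) := EuclideanSpace ℝ (Fin d)

/-- The polygonal curve (parametrized over `[0,1]`) obtained by concatenating the
segments between consecutive vertices `p 0, p 1, …, p n`. -/
def curveMap {d n : ℕ} (p : Fin (n + 1) → Euc d) (t : ℝ) : Euc d :=
  if h : n = 0 then p 0
  else
    (1 - (t * n - (min ⌊t * (n : ℝ)⌋₊ (n - 1) : ℕ))) • p ⟨min ⌊t * (n : ℝ)⌋₊ (n - 1), by omega⟩
      + (t * n - (min ⌊t * (n : ℝ)⌋₊ (n - 1) : ℕ)) • p ⟨min ⌊t * (n : ℝ)⌋₊ (n - 1) + 1, by omega⟩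

/-- A reparametrization: a continuous non-decreasing surjection of `[0,1]` onto itself. -/
def IsRepar (f : ℝ → ℝ) : Prop :=
  ContinuousOn f (Icc 0 1) ∧ MonotoneOn f (Icc 0 1) ∧ f '' Icc 0 1 = Icc 0 1

/-- The (continuous) Fréchet distance between two curves `[0,1] → ℝ^d`. -/
def frechetDist {d : ℕ} (P Q : ℝ → Euc d) : ℝ :=
  sInf { r : ℝ | ∃ f g : ℝ → ℝ, IsRepar f ∧ IsRepar g ∧
    ∀ t ∈ Icc (0 : ℝ) 1, dist (P (f t)) (Q (g t)) ≤ r }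

/-- The edge (segment curve) from `a` to `b`, parametrized over `[0,1]`. -/
def seg {d : ℕ} (a b : Euc d) (t : ℝ) : Euc d := (1 - t) • a + t • b

/-- The subcurve `P[s,t]` of `P`, reparametrized over `[0,1]`. -/
def subcurve {d : ℕ} (P : ℝ → Euc d) (s t : ℝ) (u : ℝ) : Euc d := P (s + u * (t - s))

/-- All edge lengths of the polygonal curve with vertices `p` are at most `Λ`. -/
def EdgeLenLe {d n : ℕ} (p : Fin (n + 1) → Euc d) (Λ : ℝ) : Prop :=
  ∀ i : Fin n, dist (p i.castSucc) (p i.succ) ≤ Λ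

/-- The vertices `p` define a `(μ,ε)`-curve: each edge length is a non-negative integer
multiple of `ε` and is at most `μ·ε`. -/
def IsMuEpsEdges {d n : ℕ} (p : Fin (n + 1) → Euc d) (μ : ℕ) (ε : ℝ) : Prop :=
  ∀ i : Fin n, (∃ m : ℕ, dist (p i.castSucc) (p i.succ) = m * ε) ∧
    dist (p i.castSucc) (p i.succ) ≤ μ * ε

/-- The `Δ`-neighbourhood of a set `A ⊆ ℝ^d`. -/
def nbhd {d : ℕ} (A : Set (Euc d)) (Δ : ℝ) : Set (Euc d) :=
  { x | ∃ a ∈ A, dist x a ≤ Δ }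

/-- A curve `P : [0,1] → ℝ^d` is `c`-packed if, for every point `x` and radius `r > 0`, the
arc length of the portion of `P` inside the closed ball of radius `r` around `x` (the total
variation of `P` on the preimage of that ball) is at most `c·r`. -/
def IsCPacked {d : ℕ} (P : ℝ → Euc d) (c : ℝ) : Prop :=
  ∀ (x : Euc d) (r : ℝ), 0 < r →
    eVariationOn P (Icc 0 1 ∩ P ⁻¹' closedBall x r) ≤ ENNReal.ofReal (c * r)

def extv {d n : ℕ} (p : Fin (n + 1) → Euc d) (i : ℕ) : Euc d := p ⟨min i n, by omega⟩

def fl (n : ℕ) (t : ℝ) : ℕ := min ⌊t * (n : ℝ)⌋₊ (n - 1)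

lemma curveMap_eq {d n : ℕ} (p : Fin (n + 1) → Euc d) (t : ℝ) :
    curveMap p t = (1 - (t * n - fl n t)) • extv p (fl n t)
      + (t * n - fl n t) • extv p (fl n t + 1) := by
  unfold curveMap
  split_ifs with h
  · subst h
    simp [extv, fl]
  · have h1 : min (fl n t) n = min ⌊t * (n : ℝ)⌋₊ (n - 1) := by unfold fl; omega
    have h2 : min (fl n t + 1) n = min ⌊t * (n : ℝ)⌋₊ (n - 1) + 1 := by unfold fl; omega
    simp only [extv, h1, h2]
    rfl

lemma fl_le {n : ℕ} {t : ℝ} (h0 : 0 ≤ t) : (fl n t : ℝ) ≤ t * n := by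
  have h : (fl n t : ℝ) ≤ (⌊t * (n : ℝ)⌋₊ : ℝ) := by
    exact_mod_cast min_le_left _ _
  exact h.trans (Nat.floor_le (by positivity))

lemma le_fl {n : ℕ} {t : ℝ} (h1 : t ≤ 1) : t * n ≤ fl n t + 1 := by
  unfold fl
  rcases le_total ⌊t * (n : ℝ)⌋₊ (n - 1) with h | h
  · rw [min_eq_left h]
    exact (Nat.lt_floor_add_one _).le
  · rw [min_eq_right h]
    have : (n : ℝ) ≤ ((n - 1 : ℕ) : ℝ) + 1 := by
      have : n ≤ (n - 1) + 1 := by omega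
      exact_mod_cast this
    have h2 : t * n ≤ 1 * n := by gcongr
    linarith

lemma fl_mono {n : ℕ} {s t : ℝ} (h : s ≤ t) : fl n s ≤ fl n t := by
  unfold fl
  have : ⌊s * (n : ℝ)⌋₊ ≤ ⌊t * (n : ℝ)⌋₊ := Nat.floor_mono (by gcongr)
  omega

/-- a parameter in the `i`-th edge interval is sent to the `i`-th edge. -/
lemma curveMap_edge {d m : ℕ} (p : Fin (m + 1) → Euc d) {i : ℕ} (hi : i + 1 ≤ m) {s : ℝ}
    (h0 : (i : ℝ) ≤ s * m) (h1 : s * m ≤ i + 1) :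
    curveMap p s = (1 - (s * m - i)) • extv p i + (s * m - i) • extv p (i + 1) := by
  rw [curveMap_eq]
  rcases h1.lt_or_eq with h | h
  · have hf : ⌊s * (m : ℝ)⌋₊ = i := (Nat.floor_eq_iff (le_trans (by positivity) h0)).2 ⟨h0, h⟩
    have : fl m s = i := by unfold fl; omega
    rw [this]
  · have hf : ⌊s * (m : ℝ)⌋₊ = i + 1 := by rw [h]; exact_mod_cast Nat.floor_natCast (i + 1)
    by_cases hm : i + 1 = m
    · have : fl m s = i := by unfold fl; omega
      rw [this]
    · have : fl m s = i + 1 := by unfold fl; omega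
      rw [this, h]; simp

lemma curveMap_vertex {d m : ℕ} (p : Fin (m + 1) → Euc d) {i : ℕ} (hi : i ≤ m) :
    curveMap p ((i : ℝ) / m) = extv p i := by
  rcases Nat.eq_zero_or_pos m with h | h
  · subst h
    simp [curveMap, extv]
  · have hm : (m : ℝ) ≠ 0 := by positivity
    have hs : (i : ℝ) / m * m = i := by field_simp
    rcases hi.lt_or_eq with h2 | h2
    · rw [curveMap_edge p (i := i) (by omega) (by rw [hs]) (by rw [hs]; linarith), hs]; simp
    · obtain ⟨j, rfl⟩ : ∃ j, i = j + 1 := ⟨i - 1, by omega⟩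
      rw [curveMap_edge p (i := j) (by omega) (by rw [hs]; push_cast; linarith)
        (by rw [hs]; push_cast; linarith), hs]
      simp

lemma dist_curveMap_le {d m : ℕ} (p q : Fin (m + 1) → Euc d) {r : ℝ}
    (h : ∀ i, i ≤ m → dist (extv p i) (extv q i) ≤ r) {t : ℝ} (h0 : 0 ≤ t) (h1 : t ≤ 1) :
    dist (curveMap p t) (curveMap q t) ≤ r := by
  have h' : ∀ i, dist (extv p i) (extv q i) ≤ r := by
    intro i
    have := h (min i m) (by omega)
    simpa [extv] using this
  rw [curveMap_eq, curveMap_eq]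
  set a := t * (m : ℝ) - fl m t
  have ha0 : 0 ≤ a := by have := fl_le (n := m) h0; simp only [a]; linarith
  have ha1 : a ≤ 1 := by have := le_fl (n := m) h1; simp only [a]; linarith
  calc _ ≤ dist ((1 - a) • extv p (fl m t)) ((1 - a) • extv q (fl m t))
        + dist (a • extv p (fl m t + 1)) (a • extv q (fl m t + 1)) := dist_add_add_le _ _ _ _
    _ = (1 - a) * dist (extv p (fl m t)) (extv q (fl m t))
        + a * dist (extv p (fl m t + 1)) (extv q (fl m t + 1)) := by
        rw [dist_smul₀, dist_smul₀, Real.norm_of_nonneg ha0, Real.norm_of_nonneg (by linarith)]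
    _ ≤ (1 - a) * r + a * r := by
        have := mul_le_mul_of_nonneg_left (h' (fl m t)) (by linarith : 0 ≤ 1 - a)
        have := mul_le_mul_of_nonneg_left (h' (fl m t + 1)) ha0
        linarith
    _ = r := by ring

lemma isRepar_id : IsRepar (fun t => t) :=
  ⟨continuousOn_id, fun _ _ _ _ h => h, by simp⟩

lemma frechet_le {d m : ℕ} (p q : Fin (m + 1) → Euc d) {r : ℝ}
    (h : ∀ i, i ≤ m → dist (extv p i) (extv q i) ≤ r) :
    frechetDist (curveMap p) (curveMap q) ≤ r := by
  apply csInf_le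
  · refine ⟨0, ?_⟩
    rintro x ⟨f, g, _, _, hx⟩
    exact dist_nonneg.trans (hx 0 (by simp))
  · exact ⟨_, _, isRepar_id, isRepar_id, fun t ht => dist_curveMap_le p q h ht.1 ht.2⟩

lemma curveMap_bdd {d n : ℕ} (p : Fin (n + 1) → Euc d) :
    ∃ B : ℝ, ∀ t ∈ Icc (0 : ℝ) 1, dist (curveMap p t) 0 ≤ B := by
  refine ⟨∑ i, ‖p i‖, fun t ht => ?_⟩
  have h0 : curveMap (fun _ : Fin (n + 1) => (0 : Euc d)) t = 0 := by
    rw [curveMap_eq]; simp [extv]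
  rw [← h0]
  refine dist_curveMap_le p _ (fun i hi => ?_) ht.1 ht.2
  simp only [extv, dist_zero_right]
  exact Finset.single_le_sum (f := fun i => ‖p i‖) (fun _ _ => norm_nonneg _) (Finset.mem_univ _)

lemma exists_repar {d n m : ℕ} (p : Fin (n + 1) → Euc d) (q : Fin (m + 1) → Euc d) {Δ D : ℝ}
    (hD : Δ < D) (h : frechetDist (curveMap p) (curveMap q) ≤ Δ) :
    ∃ f g : ℝ → ℝ, IsRepar f ∧ IsRepar g ∧
      ∀ t ∈ Icc (0 : ℝ) 1, dist (curveMap p (f t)) (curveMap q (g t)) ≤ D := by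
  obtain ⟨B, hB⟩ := curveMap_bdd p
  obtain ⟨B', hB'⟩ := curveMap_bdd q
  obtain ⟨r, ⟨f, g, hf, hg, hr⟩, hrD⟩ := exists_lt_of_csInf_lt
    (s := { r : ℝ | ∃ f g : ℝ → ℝ, IsRepar f ∧ IsRepar g ∧
      ∀ t ∈ Icc (0 : ℝ) 1, dist (curveMap p (f t)) (curveMap q (g t)) ≤ r })
    ⟨B + B', _, _, isRepar_id, isRepar_id, fun t ht =>
      (dist_triangle_right _ _ 0).trans (add_le_add (hB t ht) (hB' t ht))⟩
    (lt_of_le_of_lt h hD)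
  exact ⟨f, g, hf, hg, fun t ht => (hr t ht).trans hrD.le⟩

lemma IsRepar.mem {f : ℝ → ℝ} (hf : IsRepar f) {t : ℝ} (ht : t ∈ Icc (0 : ℝ) 1) :
    f t ∈ Icc (0 : ℝ) 1 := by
  rw [← hf.2.2]; exact ⟨t, ht, rfl⟩

lemma IsRepar.zero {f : ℝ → ℝ} (hf : IsRepar f) : f 0 = 0 := by
  have : (0 : ℝ) ∈ f '' Icc 0 1 := by rw [hf.2.2]; simp
  obtain ⟨t, ht, h⟩ := this
  have := hf.2.1 (by simp) ht ht.1
  have := (hf.mem (t := 0) (by simp)).1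
  linarith

/-- unit direction of the `l`-th edge (or zero) -/
def dirv {d n : ℕ} (p : Fin (n + 1) → Euc d) (l : ℕ) : Euc d :=
  ‖extv p (l + 1) - extv p l‖⁻¹ • (extv p (l + 1) - extv p l)

/-- predicted location of the next vertex -/
def ctr {d n : ℕ} (p : Fin (n + 1) → Euc d) (l l' : ℕ) (L : ℝ) (z : Euc d) : Euc d :=
  if l = l' then z + L • dirv p l'
  else extv p l' + (L - dist z (extv p l')) • dirv p l'

lemma norm_dirv_le {d n : ℕ} (p : Fin (n + 1) → Euc d) (l : ℕ) : ‖dirv p l‖ ≤ 1 := by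
  unfold dirv
  rw [norm_smul, norm_inv, norm_norm]
  exact inv_mul_le_one

lemma curveMap_dirv {d n : ℕ} (p : Fin (n + 1) → Euc d) (t : ℝ) :
    curveMap p t = extv p (fl n t) + ((t * n - fl n t) *
      ‖extv p (fl n t + 1) - extv p (fl n t)‖) • dirv p (fl n t) := by
  rw [curveMap_eq]
  unfold dirv
  set v := extv p (fl n t + 1)
  set w := extv p (fl n t)
  rcases eq_or_ne v w with h | h
  · simp [h, ← add_smul]
  · have : ‖v - w‖ ≠ 0 := by simpa [sub_eq_zero] using h
    rw [smul_smul, mul_assoc, mul_inv_cancel₀ this]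
    simp only [mul_one, sub_smul, smul_sub, one_smul]
    abel

lemma norm_smul_dirv {d n : ℕ} (p : Fin (n + 1) → Euc d) (l : ℕ) {τ : ℝ} (h : 0 ≤ τ) :
    ‖(τ * ‖extv p (l + 1) - extv p l‖) • dirv p l‖ = τ * ‖extv p (l + 1) - extv p l‖ := by
  unfold dirv
  set v := extv p (l + 1) - extv p l
  rcases eq_or_ne v 0 with hv | hv
  · simp [hv]
  · have : ‖v‖ ≠ 0 := by simpa using hv
    rw [norm_smul, norm_smul, norm_inv, norm_norm, inv_mul_cancel₀ this, mul_one,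
      Real.norm_of_nonneg (by positivity)]

lemma geoA {E : Type*} [NormedAddCommGroup E] [NormedSpace ℝ E] {q q' x p y z u : E}
    {a D δ lam : ℝ} (hu : ‖u‖ ≤ 1) (hy : y = p + a • u) (ha : ‖a • u‖ = a)
    (hx : x = (1 - lam) • q + lam • q') (l0 : 0 ≤ lam) (l1 : lam ≤ 1)
    (hpx : dist p x ≤ D) (hyq : dist y q' ≤ D) (hz : dist q z ≤ δ) :
    dist q' (p + (dist q q' - dist z p) • u) ≤ δ + 4 * D := by
  have hsplit : dist q q' = dist q x + dist x q' := by
    have e1 : q - x = lam • (q - q') := by rw [hx]; simp only [sub_smul, smul_sub, one_smul]; abel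
    have e2 : x - q' = (1 - lam) • (q - q') := by
      rw [hx]; simp only [sub_smul, smul_sub, one_smul]; abel
    rw [dist_eq_norm q x, dist_eq_norm x q', e1, e2, norm_smul, norm_smul,
      Real.norm_of_nonneg l0, Real.norm_of_nonneg (by linarith : 0 ≤ 1 - lam), dist_eq_norm]
    ring
  have hpy : dist p y = a := by rw [hy, dist_self_add_right, ha]
  have t1 := dist_triangle q x p
  have t2 := dist_triangle q p x
  have t3 := dist_triangle z q p
  have t4 := dist_triangle q z p
  have t5 := dist_triangle x p y
  have t6 := dist_triangle x y q'
  have t7 := dist_triangle p x y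
  have t8 := dist_triangle x q' y
  rw [dist_comm x p] at *
  rw [dist_comm z q] at *
  rw [dist_comm q' y] at *
  have habs : |a - (dist q q' - dist z p)| ≤ δ + 3 * D := by
    rw [abs_le]; constructor <;> linarith
  have h1 : dist y (p + (dist q q' - dist z p) • u) ≤ δ + 3 * D := by
    rw [hy, dist_add_left, dist_eq_norm, ← sub_smul, norm_smul, Real.norm_eq_abs]
    calc _ ≤ |a - (dist q q' - dist z p)| * 1 := by gcongr
      _ ≤ _ := by linarith
  have t9 := dist_triangle q' y (p + (dist q q' - dist z p) • u)
  rw [dist_comm q' y] at t9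
  linarith

lemma geoB {E : Type*} [NormedAddCommGroup E] [NormedSpace ℝ E] {q q' y y' z u : E}
    {a D δ : ℝ} (hu : ‖u‖ ≤ 1) (hy : y' = y + a • u) (ha : ‖a • u‖ = a)
    (hyq : dist y q ≤ D) (hyq' : dist y' q' ≤ D) (hz : dist q z ≤ δ) :
    dist q' (z + dist q q' • u) ≤ δ + 4 * D := by
  have hyy : dist y y' = a := by rw [hy, dist_self_add_right, ha]
  have t1 := dist_triangle4 q y y' q'
  have t2 := dist_triangle4 y q q' y'
  rw [dist_comm q y] at t1
  rw [dist_comm q' y'] at t2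
  have habs : |a - dist q q'| ≤ 2 * D := by
    rw [abs_le]; constructor <;> linarith
  have h1 : dist y' (y + dist q q' • u) ≤ 2 * D := by
    rw [hy, dist_add_left, dist_eq_norm, ← sub_smul, norm_smul, Real.norm_eq_abs]
    calc _ ≤ |a - dist q q'| * 1 := by gcongr
      _ ≤ _ := by linarith
  have h2 : dist (y + dist q q' • u) (z + dist q q' • u) ≤ D + δ := by
    rw [dist_add_right]
    exact (dist_triangle y q z).trans (add_le_add hyq hz)
  have t3 := dist_triangle4 q' y' (y + dist q q' • u) (z + dist q q' • u)
  rw [dist_comm q' y'] at t3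
  linarith

lemma exists_labels {d n m : ℕ} (p : Fin (n + 1) → Euc d) (r : Fin (m + 1) → Euc d) {Δ D : ℝ}
    (hD : Δ < D) (h : frechetDist (curveMap p) (curveMap r) ≤ Δ) :
    ∃ l : ℕ → ℕ, Monotone l ∧ (∀ i, l i ≤ n) ∧ dist (extv r 0) (extv p 0) ≤ D ∧
      ∀ i, i + 1 ≤ m → ∀ z δ, dist (extv r i) z ≤ δ →
        dist (extv r (i + 1)) (ctr p (l i) (l (i + 1)) (dist (extv r i) (extv r (i + 1))) z)
          ≤ δ + 4 * D := by
  obtain ⟨f, g, hf, hg, hfg⟩ := exists_repar p r hD h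
  have hT : ∀ j : ℕ, ∃ t ∈ Icc (0 : ℝ) 1, g t = ((min j m : ℕ) : ℝ) / m := by
    intro j
    have : ((min j m : ℕ) : ℝ) / m ∈ g '' Icc 0 1 := by
      rw [hg.2.2]
      refine ⟨by positivity, div_le_one_of_le₀ (by exact_mod_cast min_le_right _ _) (by positivity)⟩
    exact this
  choose T hT01 hgT using hT
  set t : ℕ → ℝ := fun i => T (min i m) with ht
  have ht01 : ∀ i, t i ∈ Icc (0 : ℝ) 1 := fun i => hT01 _
  have hgt : ∀ i, g (t i) = ((min i m : ℕ) : ℝ) / m := by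
    intro i
    simp only [ht, hgT]; simp
  have htm : Monotone t := by
    intro i j hij
    rcases (min_le_min_right m hij).eq_or_lt with he | hlt
    · simp only [ht, he, le_refl]
    · by_contra hcon
      push Not at hcon
      have := hg.2.1 (ht01 j) (ht01 i) hcon.le
      rw [hgt, hgt] at this
      have hm : (0 : ℝ) < m := by
        have : 0 < m := by omega
        exact_mod_cast this
      rw [div_le_div_iff_of_pos_right hm] at this
      have : min j m ≤ min i m := by exact_mod_cast this
      omega
  have hft : ∀ i, f (t i) ∈ Icc (0 : ℝ) 1 := fun i => hf.mem (ht01 i)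
  have hvert : ∀ i, i ≤ m → curveMap r (g (t i)) = extv r i := by
    intro i hi
    rw [hgt, min_eq_left hi, curveMap_vertex r hi]
  have hlm : Monotone (fun i => fl n (f (t i))) := fun i j hij =>
    fl_mono (hf.2.1 (ht01 i) (ht01 j) (htm hij))
  refine ⟨fun i => fl n (f (t i)), hlm, fun i => ?_, ?_, ?_⟩
  · show fl n _ ≤ n
    unfold fl; omega
  · have := hfg 0 (by simp)
    rw [hf.zero, hg.zero] at this
    have e1 := curveMap_vertex p (Nat.zero_le n)
    have e2 := curveMap_vertex r (Nat.zero_le m)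
    simp only [Nat.cast_zero, zero_div] at e1 e2
    rwa [e1, e2, dist_comm] at this
  · intro i hi z δ hz
    have hd0 := hfg (t i) (ht01 i)
    have hd1 := hfg (t (i + 1)) (ht01 _)
    rw [hvert i (by omega)] at hd0
    rw [hvert (i + 1) hi] at hd1
    have hll := hlm (Nat.le_succ i)
    simp only [Nat.succ_eq_add_one] at hll
    have e0 := curveMap_dirv p (f (t i))
    have e1 := curveMap_dirv p (f (t (i + 1)))
    have hfle : f (t i) ≤ f (t (i + 1)) := hf.2.1 (ht01 i) (ht01 _) (htm (Nat.le_succ i))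
    have hm : (0 : ℝ) < m := by
      have : 0 < m := by omega
      exact_mod_cast this
    unfold ctr
    dsimp only
    split_ifs with hl
    · rw [hl] at e0
      set l := fl n (f (t (i + 1)))
      have hτ : 0 ≤ f (t (i + 1)) * n - f (t i) * n := by
        have := mul_le_mul_of_nonneg_right hfle (Nat.cast_nonneg (α := ℝ) n)
        linarith
      refine geoB (norm_dirv_le p l) (y := curveMap p (f (t i)))
        (y' := curveMap p (f (t (i + 1)))) ?_ (norm_smul_dirv p l hτ) hd0 hd1 hz
      rw [e1, e0, add_assoc, ← add_smul]
      congr 2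
      ring
    · set l := fl n (f (t (i + 1))) with hldef
      have hlt : fl n (f (t i)) < l := lt_of_le_of_ne hll hl
      have hln : l ≤ n - 1 := by rw [hldef]; unfold fl; omega
      have hn : (0 : ℝ) < n := by
        have : 0 < n := by omega
        exact_mod_cast this
      have hlo : f (t i) ≤ (l : ℝ) / n := by
        rw [le_div_iff₀ hn]
        have h1 := le_fl (n := n) (hft i).2
        have : ((fl n (f (t i)) : ℕ) : ℝ) + 1 ≤ l := by exact_mod_cast hlt
        linarith
      have hhi : (l : ℝ) / n ≤ f (t (i + 1)) := by
        rw [div_le_iff₀ hn]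
        exact fl_le (hft _).1
      have htle : t i ≤ t (i + 1) := htm (Nat.le_succ i)
      obtain ⟨s, hs, hfs⟩ := intermediate_value_Icc htle
        (hf.1.mono (Icc_subset_Icc (ht01 i).1 (ht01 (i + 1)).2)) ⟨hlo, hhi⟩
      have hs01 : s ∈ Icc (0 : ℝ) 1 := ⟨(ht01 i).1.trans hs.1, hs.2.trans (ht01 _).2⟩
      have hds := hfg s hs01
      rw [hfs, curveMap_vertex p (by omega)] at hds
      have g0 := hg.2.1 (ht01 i) hs01 hs.1
      have g1 := hg.2.1 hs01 (ht01 (i + 1)) hs.2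
      rw [hgt, min_eq_left (by omega), div_le_iff₀ hm] at g0
      rw [hgt, min_eq_left hi, le_div_iff₀ hm] at g1
      push_cast at g1
      refine geoA (norm_dirv_le p l) e1 (norm_smul_dirv p l ?_)
        (curveMap_edge r hi g0 g1) (by linarith) (by linarith) hds hd1 hz
      have := fl_le (n := n) (hft (i + 1)).1
      linarith

lemma net_one (d : ℕ) : ∃ S : Finset (Euc d), S.card ≤ 5 ^ d ∧
    ∀ x : Euc d, ‖x‖ ≤ 2 → ∃ y ∈ S, ‖x - y‖ ≤ 1 := by
  classical
  by_contra hcon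
  push Not at hcon
  have hcard : ∀ S : Finset (Euc d), (∀ c ∈ S, ‖c‖ ≤ 2) →
      (∀ c ∈ S, ∀ d ∈ S, c ≠ d → 1 ≤ ‖c - d‖) → S.card ≤ 5 ^ d := by
    intro S h1 h2
    have := Besicovitch.card_le_of_separated S h1 h2
    simpa using this
  have key : ∀ N : ℕ, ∃ S : Finset (Euc d), (∀ c ∈ S, ‖c‖ ≤ 2) ∧
      (∀ c ∈ S, ∀ d ∈ S, c ≠ d → 1 ≤ ‖c - d‖) ∧ S.card = N := by
    intro N
    induction N with
    | zero => exact ⟨∅, by simp⟩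
    | succ N ih =>
      obtain ⟨S, h1, h2, h3⟩ := ih
      obtain ⟨x, hx, hxS⟩ := hcon S (hcard S h1 h2)
      have hnot : x ∉ S := fun h => by
        have := hxS x h
        simp at this
        linarith
      refine ⟨insert x S, ?_, ?_, ?_⟩
      · intro c hc
        rcases Finset.mem_insert.1 hc with rfl | hc
        · exact hx
        · exact h1 c hc
      · intro a ha b hb hab
        rcases Finset.mem_insert.1 ha with ea | ha' <;>
          rcases Finset.mem_insert.1 hb with eb | hb'
        · exact absurd (ea.trans eb.symm) hab
        · rw [ea]; exact (hxS b hb').le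
        · rw [eb, norm_sub_rev]; exact (hxS a ha').le
        · exact h2 a ha' b hb' hab
      · rw [Finset.card_insert_of_notMem hnot, h3]
  obtain ⟨S, h1, h2, h3⟩ := key (5 ^ d + 1)
  have := hcard S h1 h2
  omega

lemma net_pow (d s : ℕ) : ∃ S : Finset (Euc d), S.card ≤ (5 ^ d) ^ s ∧
    ∀ x : Euc d, ‖x‖ ≤ 2 ^ s → ∃ y ∈ S, ‖x - y‖ ≤ 1 := by
  classical
  obtain ⟨S1, c1, h1⟩ := net_one d
  induction s with
  | zero => exact ⟨{0}, by simp, fun x hx => ⟨0, by simp, by simpa using hx⟩⟩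
  | succ s ih =>
    obtain ⟨S, c, h⟩ := ih
    refine ⟨Finset.image₂ (fun w y => w + (2 : ℝ) ^ s • y) S S1, ?_, ?_⟩
    · refine (Finset.card_image₂_le _ _ _).trans ?_
      rw [pow_succ]
      gcongr
    · intro x hx
      have h2 : (0 : ℝ) < 2 ^ s := by positivity
      obtain ⟨y, hy, hxy⟩ := h1 (((2 : ℝ) ^ s)⁻¹ • x) (by
        rw [norm_smul, norm_inv, Real.norm_of_nonneg h2.le, inv_mul_le_iff₀ h2, ← pow_succ]
        exact hx)
      have e : x - (2 : ℝ) ^ s • y = (2 : ℝ) ^ s • (((2 : ℝ) ^ s)⁻¹ • x - y) := by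
        rw [smul_sub, smul_smul, mul_inv_cancel₀ h2.ne', one_smul]
      obtain ⟨w, hw, hxw⟩ := h (x - (2 : ℝ) ^ s • y) (by
        rw [e, norm_smul, Real.norm_of_nonneg h2.le]
        exact mul_le_of_le_one_right h2.le hxy)
      refine ⟨w + (2 : ℝ) ^ s • y, Finset.mem_image₂_of_mem hw hy, ?_⟩
      convert hxw using 2
      abel

lemma net_fin (d : ℕ) {ρ : ℝ} (hρ : 0 < ρ) : ∃ net : Fin ((5 ^ d) ^ 6) → Euc d,
    ∀ x : Euc d, ‖x‖ ≤ 64 * ρ → ∃ i, ‖x - net i‖ ≤ ρ := by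
  obtain ⟨S, c, h⟩ := net_pow d 6
  refine ⟨fun i => if hi : i.1 < S.card then ρ • (S.equivFin.symm ⟨i.1, hi⟩ : Euc d) else 0, ?_⟩
  intro x hx
  obtain ⟨y, hy, hxy⟩ := h (ρ⁻¹ • x) (by
    rw [norm_smul, norm_inv, Real.norm_of_nonneg hρ.le, inv_mul_le_iff₀ hρ]
    linarith)
  have hlt := (S.equivFin ⟨y, hy⟩).2
  refine ⟨⟨(S.equivFin ⟨y, hy⟩).1, lt_of_lt_of_le hlt c⟩, ?_⟩
  simp only [hlt, dif_pos, Fin.eta, Equiv.symm_apply_apply]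
  have e : x - ρ • y = ρ • (ρ⁻¹ • x - y) := by
    rw [smul_sub, smul_smul, mul_inv_cancel₀ hρ.ne', one_smul]
  rw [e, norm_smul, Real.norm_of_nonneg hρ.le]
  exact mul_le_of_le_one_right hρ.le hxy

/-- base points of the iterative encoding -/
def bseq {E : Type*} [AddCommGroup E] {N : ℕ} (b0 : E) (F : ℕ → E → E) (net : Fin N → E)
    (pick : E → Fin N) (q : ℕ → E) : ℕ → E
  | 0 => b0
  | i + 1 => F i (bseq b0 F net pick q i + net (pick (q i - bseq b0 F net pick q i)))

lemma bseq_close {d N m : ℕ} {b0 : Euc d} {F : ℕ → Euc d → Euc d} {net : Fin N → Euc d}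
    {pick : Euc d → Fin N} {q : ℕ → Euc d} {ρ : ℝ}
    (hpick : ∀ x, ‖x‖ ≤ 64 * ρ → ‖x - net (pick x)‖ ≤ ρ)
    (h0 : dist (q 0) b0 ≤ 64 * ρ)
    (hF : ∀ i, i + 1 ≤ m → ∀ z, dist (q i) z ≤ ρ → dist (q (i + 1)) (F i z) ≤ 64 * ρ) :
    ∀ i, i ≤ m → dist (q i) (bseq b0 F net pick q i + net (pick (q i - bseq b0 F net pick q i)))
      ≤ ρ := by
  have step : ∀ i, dist (q i) (bseq b0 F net pick q i) ≤ 64 * ρ →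
      dist (q i) (bseq b0 F net pick q i + net (pick (q i - bseq b0 F net pick q i))) ≤ ρ := by
    intro i h
    rw [dist_eq_norm] at h ⊢
    rw [← sub_sub]
    exact hpick _ h
  intro i
  induction i with
  | zero => intro _; exact step 0 h0
  | succ i ih =>
    intro hi
    exact step _ (hF i hi _ (ih (by omega)))

lemma bseq_eq {d N m : ℕ} {b0 : Euc d} {F F' : ℕ → Euc d → Euc d} {net : Fin N → Euc d}
    {pick : Euc d → Fin N} {q q' : ℕ → Euc d}
    (hF : ∀ i, i + 1 ≤ m → F i = F' i)
    (hw : ∀ i, i ≤ m → pick (q i - bseq b0 F net pick q i) = pick (q' i - bseq b0 F' net pick q' i)) :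
    ∀ i, i ≤ m → bseq b0 F net pick q i = bseq b0 F' net pick q' i := by
  intro i
  induction i with
  | zero => intro _; rfl
  | succ i ih =>
    intro hi
    have h1 := ih (by omega)
    have h2 := hw i (by omega)
    simp only [bseq]
    rw [h2, h1, hF i hi]

/-- the type of codes -/
abbrev CodeT (d k μ : ℕ) : Type :=
  Fin k × Finset (Fin (2 * k)) × (Fin k → Fin (μ + 1)) × (Fin k → Fin ((5 ^ d) ^ 6))

/-- the curves in the Fréchet ball -/
abbrev CurveX {d n : ℕ} (P : Fin (n + 1) → Euc d) (k μ : ℕ) (c ε Δ : ℝ) : Type :=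
  { R : Σ m : ℕ, Fin (m + 1) → Euc d // R.1 + 1 ≤ k ∧ IsMuEpsEdges R.2 μ ε ∧
    IsCPacked (curveMap R.2) c ∧ frechetDist (curveMap P) (curveMap R.2) ≤ Δ }

lemma card_code (d k μ : ℕ) (hk : 1 ≤ k) (hd : 1 ≤ d) (hμ : 1 ≤ μ) :
    (Fintype.card (CodeT d k μ) : ℝ) ≤ ((16 * 5 ^ 6 : ℝ) ^ d * μ) ^ k := by
  simp only [CodeT, Fintype.card_prod, Fintype.card_fin, Fintype.card_finset, Fintype.card_fun]
  push_cast
  have h1 : (k : ℝ) ≤ 2 ^ k := by exact_mod_cast Nat.lt_two_pow_self.le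
  have h2 : ((μ : ℝ) + 1) ≤ 2 * μ := by
    have : (1 : ℝ) ≤ μ := by exact_mod_cast hμ
    linarith
  have h3 : (16 : ℝ) ≤ 16 ^ d := le_self_pow₀ (by norm_num) (by omega)
  calc (k : ℝ) * (2 ^ (2 * k) * (((μ : ℝ) + 1) ^ k * ((5 ^ d) ^ 6) ^ k))
      ≤ (2 : ℝ) ^ k * (2 ^ (2 * k) * ((2 * (μ : ℝ)) ^ k * ((5 ^ d) ^ 6) ^ k)) := by gcongr
    _ = ((16 : ℝ) * (5 ^ 6) ^ d * (μ : ℝ)) ^ k := by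
        rw [pow_mul, ← mul_pow, ← mul_pow, ← mul_pow]
        congr 1
        rw [← pow_mul, ← pow_mul, mul_comm 6 d]
        ring
    _ ≤ ((16 : ℝ) ^ d * (5 ^ 6) ^ d * (μ : ℝ)) ^ k := by gcongr
    _ = _ := by rw [mul_pow (16 : ℝ) (5 ^ 6) d]

lemma exists_mult {d m μ : ℕ} {ε : ℝ} (hε : 0 < ε) (r : Fin (m + 1) → Euc d)
    (h : IsMuEpsEdges r μ ε) : ∃ j : ℕ → Fin (μ + 1),
      ∀ i, i + 1 ≤ m → dist (extv r i) (extv r (i + 1)) = (j i : ℕ) * ε := by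
  have : ∀ i, ∃ j : Fin (μ + 1), i + 1 ≤ m →
      dist (extv r i) (extv r (i + 1)) = (j : ℕ) * ε := by
    intro i
    by_cases hi : i + 1 ≤ m
    · obtain ⟨⟨j, hj⟩, hle⟩ := h ⟨i, hi⟩
      have hjμ : j ≤ μ := by
        rw [hj] at hle
        exact_mod_cast le_of_mul_le_mul_right hle hε
      refine ⟨⟨j, by omega⟩, fun _ => ?_⟩
      rw [← hj]
      congr 1
      · unfold extv; congr 1; ext; simp; omega
      · unfold extv; congr 1; ext; simp; omega
    · exact ⟨0, fun h => absurd h hi⟩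
  choose j hj using this
  exact ⟨j, hj⟩

/-- code of a monotone sequence -/
def monoCode (k : ℕ) (l : ℕ → ℕ) : Finset (Fin (2 * k)) :=
  Finset.univ.filter fun x => ∃ i < k, x.1 = l i + i

lemma monoCode_inj {k : ℕ} {l l' : ℕ → ℕ} (hl : Monotone l) (hl' : Monotone l')
    (hk : ∀ i, l i + 1 ≤ k) (hk' : ∀ i, l' i + 1 ≤ k) (h : monoCode k l = monoCode k l') :
    ∀ i < k, l i = l' i := by
  have hs : ∀ a : ℕ → ℕ, Monotone a → StrictMono (fun i : Fin k => a i + i.1) := by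
    intro a ha i j hij
    have := ha (Fin.lt_def.1 hij).le
    have := Fin.lt_def.1 hij
    dsimp only
    omega
  have hsub : ∀ a b : ℕ → ℕ, (∀ i, a i + 1 ≤ k) → monoCode k a = monoCode k b →
      Set.range (fun i : Fin k => a i + i.1) ⊆ Set.range (fun i : Fin k => b i + i.1) := by
    rintro a b ha hab _ ⟨i, rfl⟩
    have hlt : a i + i.1 < 2 * k := by have := ha i; have := i.2; omega
    have : (⟨a i + i.1, hlt⟩ : Fin (2 * k)) ∈ monoCode k a := by
      simp only [monoCode, Finset.mem_filter, Finset.mem_univ, true_and]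
      exact ⟨i, i.2, rfl⟩
    rw [hab] at this
    simp only [monoCode, Finset.mem_filter, Finset.mem_univ, true_and] at this
    obtain ⟨j, hj, hij⟩ := this
    exact ⟨⟨j, hj⟩, hij.symm⟩
  have := ((hs l hl).range_inj (hs l' hl')).1
    (Set.Subset.antisymm (hsub l l' hk h) (hsub l' l hk' h.symm))
  intro i hi
  have := congrFun this ⟨i, hi⟩
  simpa using this

lemma exists_code {d n k μ : ℕ} {c ε Δ : ℝ} (hε : 0 < ε) (P : Fin (n + 1) → Euc d)
    (hn : n + 1 ≤ k) (hΔ : 0 < Δ) :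
    ∃ code : CurveX P k μ c ε Δ → CodeT d k μ, ∀ R R' : CurveX P k μ c ε Δ,
      code R = code R' → frechetDist (curveMap R.1.2) (curveMap R'.1.2) ≤ Δ / 2 := by
  have hρ : 0 < Δ / 4 := by positivity
  obtain ⟨net, hnet⟩ := net_fin d hρ
  have hp : ∀ x : Euc d, ∃ i, ‖x‖ ≤ 64 * (Δ / 4) → ‖x - net i‖ ≤ Δ / 4 := by
    intro x
    by_cases hx : ‖x‖ ≤ 64 * (Δ / 4)
    · obtain ⟨i, hi⟩ := hnet x hx
      exact ⟨i, fun _ => hi⟩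
    · exact ⟨⟨0, by positivity⟩, fun h => absurd h hx⟩
  choose pick hpick using hp
  have hl : ∀ R : CurveX P k μ c ε Δ, _ := fun R =>
    exists_labels P R.1.2 (D := 2 * Δ) (by linarith) R.2.2.2.2
  choose l hlm hln h0 hstep using hl
  have hJ : ∀ R : CurveX P k μ c ε Δ, _ := fun R => exists_mult hε R.1.2 R.2.2.1
  choose J hJ using hJ
  let F : CurveX P k μ c ε Δ → ℕ → Euc d → Euc d := fun R i z =>
    ctr P (l R i) (l R (i + 1)) ((J R i : ℕ) * ε) z
  let b : CurveX P k μ c ε Δ → ℕ → Euc d := fun R =>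
    bseq (extv P 0) (F R) net pick (extv R.1.2)
  have hclose : ∀ R : CurveX P k μ c ε Δ, ∀ i, i ≤ R.1.1 →
      dist (extv R.1.2 i) (b R i + net (pick (extv R.1.2 i - b R i))) ≤ Δ / 4 := by
    intro R
    refine bseq_close hpick ((h0 R).trans (by linarith)) ?_
    intro i hi z hz
    have := hstep R i hi z _ hz
    rw [hJ R i hi] at this
    exact this.trans (by linarith)
  refine ⟨fun R => (⟨R.1.1, R.2.1⟩, monoCode k (l R), fun i => J R i,
    fun i => pick (extv R.1.2 i - b R i)), ?_⟩
  intro R R' hRR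
  simp only [Prod.mk.injEq, Fin.mk.injEq] at hRR
  obtain ⟨hm, hS, hJJ, hw⟩ := hRR
  have hll := monoCode_inj (hlm R) (hlm R') (fun i => by have := hln R i; omega)
    (fun i => by have := hln R' i; omega) hS
  have hkR := R.2.1
  have hbb : ∀ i, i ≤ R.1.1 → b R i = b R' i := by
    refine bseq_eq ?_ ?_
    · intro i hi
      have hj := congrFun hJJ ⟨i, by omega⟩
      dsimp only at hj
      simp only [F, hll i (by omega), hll (i + 1) (by omega), hj]
    · intro i hi
      exact congrFun hw ⟨i, by omega⟩
  have hfin : ∀ i, i ≤ R.1.1 → dist (extv R.1.2 i) (extv R'.1.2 i) ≤ Δ / 2 := by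
    intro i hi
    have c1 := hclose R i hi
    have c2 := hclose R' i (by omega)
    have hwi := congrFun hw ⟨i, by omega⟩
    dsimp only at hwi
    rw [hwi, hbb i hi] at c1
    have := dist_triangle_right (extv R.1.2 i) (extv R'.1.2 i)
      (b R' i + net (pick (extv R'.1.2 i - b R' i)))
    linarith
  clear_value b F
  clear hbb hw hll hclose hJJ hS
  obtain ⟨⟨m, r⟩, hr⟩ := R
  obtain ⟨⟨m', r'⟩, hr'⟩ := R'
  dsimp only at hm hfin ⊢
  subst hm
  exact frechet_le r r' hfin

/-- Corollary 3.15 of the paper. There is a universal constant `C₀ ≥ 1`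
such that every Fréchet ball of radius `Δ` centered at a `c`-packed `(μ,ε)`-curve of
complexity at most `k` in `ℝ^d` can be covered by at most `(C₀^d·(c+1)·μ)^k` Fréchet balls
of radius `Δ/2` centered at `c`-packed `(μ,ε)`-curves; hence the doubling dimension of the
space of `c`-packed `(μ,ε)`-curves is `O(k(d + log(cμ)))`. -/
theorem doubling_bound_cpacked :
    ∃ C₀ : ℝ, 1 ≤ C₀ ∧
      ∀ (d k μ : ℕ), 1 ≤ d → 1 ≤ k → 1 ≤ μ →
      ∀ c ε : ℝ, 0 < c → 0 < ε →
      ∀ (n : ℕ) (P : Fin (n + 1) → Euc d), n + 1 ≤ k → IsMuEpsEdges P μ ε →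
        IsCPacked (curveMap P) c →
      ∀ Δ : ℝ, 0 < Δ →
      ∃ (M : ℕ) (Q : Fin M → Σ m : ℕ, Fin (m + 1) → Euc d),
        (M : ℝ) ≤ (C₀ ^ d * (c + 1) * μ) ^ k ∧
        (∀ i, (Q i).1 + 1 ≤ k ∧ IsMuEpsEdges (Q i).2 μ ε ∧ IsCPacked (curveMap (Q i).2) c) ∧
        ∀ (m : ℕ) (R : Fin (m + 1) → Euc d), m + 1 ≤ k → IsMuEpsEdges R μ ε →
          IsCPacked (curveMap R) c →
          frechetDist (curveMap P) (curveMap R) ≤ Δ →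
          ∃ i, frechetDist (curveMap R) (curveMap (Q i).2) ≤ Δ / 2 := by
  refine ⟨16 * 5 ^ 6, by norm_num, ?_⟩
  intro d k μ hd hk hμ c ε hc hε n P hn hPe hPc Δ hΔ
  obtain ⟨code, hcode⟩ := exists_code (k := k) (μ := μ) (c := c) (ε := ε) hε P hn hΔ
  classical
  let e := (Fintype.equivFin (CodeT d k μ)).symm
  let Q : CodeT d k μ → Σ m : ℕ, Fin (m + 1) → Euc d := fun a =>
    if h : ∃ R : CurveX P k μ c ε Δ, code R = a then h.choose.1 else ⟨n, P⟩
  refine ⟨Fintype.card (CodeT d k μ), fun i => Q (e i), ?_, ?_, ?_⟩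
  · refine (card_code d k μ hk hd hμ).trans ?_
    gcongr
    have h1 : (0 : ℝ) ≤ (16 * 5 ^ 6 : ℝ) ^ d := by positivity
    nlinarith
  · intro i
    by_cases h : ∃ R : CurveX P k μ c ε Δ, code R = e i
    · have hq : Q (e i) = h.choose.1 := by simp only [Q, dif_pos h]
      dsimp only
      rw [hq]
      have := h.choose.2
      exact ⟨this.1, this.2.1, this.2.2.1⟩
    · have hq : Q (e i) = ⟨n, P⟩ := by simp only [Q, dif_neg h]
      dsimp only
      rw [hq]
      exact ⟨hn, hPe, hPc⟩
  · intro m R hm hRe hRc hF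
    let X : CurveX P k μ c ε Δ := ⟨⟨m, R⟩, hm, hRe, hRc, hF⟩
    refine ⟨e.symm (code X), ?_⟩
    have h : ∃ R : CurveX P k μ c ε Δ, code R = code X := ⟨X, rfl⟩
    have h2 : Q (e (e.symm (code X))) = h.choose.1 := by
      rw [Equiv.apply_symm_apply]
      simp only [Q, dif_pos h]
    show frechetDist (curveMap R) (curveMap (Q (e (e.symm (code X)))).2) ≤ Δ / 2
    rw [h2]
    exact hcode X h.choose h.choose_spec.symm
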